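/- If a 3-connected graph contains an even cycle and an odd cycle sharing exactly one common vertex, then it contains two cycles of consecutive even lengths. -/

import Mathlib

open SimpleGraph

/-- `G` contains two cycles of consecutive even lengths `2m` and `2m+2`. -/
def HasTwoConsecEvenCycles {V : Type*} (G : SimpleGraph V) : Prop :=
  ∃ (u v : V) (c₁ : G.Walk u u) (c₂ : G.Walk v v) (m : ℕ),
    c₁.IsCycle ∧ c₂.IsCycle ∧ 0 < m ∧ c₁.length = 2 * m ∧ c₂.length = 2 * m + 2

/-- `G` is `k`-connected: more than `k` vertices, and deleting any set of
fewer than `k` vertices leaves a connected graph. -/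
def KConnected {V : Type*} (k : ℕ) (G : SimpleGraph V) : Prop :=
  k + 1 ≤ Nat.card V ∧ ∀ S : Set V, S.ncard < k → (G.induce Sᶜ).Connected


namespace ConsecEven

variable {V : Type*} {G : SimpleGraph V}

/-- there is a path of length `n` from `x` to `y` inside `S`. -/
def PP (G : SimpleGraph V) (S : Set V) (x y : V) (n : ℕ) : Prop :=
  ∃ p : G.Walk x y, p.IsPath ∧ p.length = n ∧ ∀ v ∈ p.support, v ∈ S

/-- there is a cycle of length `n` inside `S`. -/
def Cyc (G : SimpleGraph V) (S : Set V) (n : ℕ) : Prop :=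
  ∃ (x : V) (w : G.Walk x x), w.IsCycle ∧ w.length = n ∧ ∀ v ∈ w.support, v ∈ S

/-- `x` and `y` are linked inside `S`. -/
def Lk (G : SimpleGraph V) (S : Set V) (x y : V) : Prop :=
  ∃ p : G.Walk x y, ∀ v ∈ p.support, v ∈ S

/-- all pairs in `S` are linked inside `S`. -/
def Conn (G : SimpleGraph V) (S : Set V) : Prop := ∀ x ∈ S, ∀ y ∈ S, Lk G S x y

theorem PP.mono {S T : Set V} {x y : V} {n : ℕ} (h : PP G S x y n) (hST : S ⊆ T) :
    PP G T x y n := by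
  obtain ⟨p, h1, h2, h3⟩ := h
  exact ⟨p, h1, h2, fun v hv => hST (h3 v hv)⟩

theorem PP.symm {S : Set V} {x y : V} {n : ℕ} (h : PP G S x y n) : PP G S y x n := by
  obtain ⟨p, h1, h2, h3⟩ := h
  exact ⟨p.reverse, h1.reverse, by simpa using h2, fun v hv => h3 v (by simpa using hv)⟩

theorem PP.left_mem {S : Set V} {x y : V} {n : ℕ} (h : PP G S x y n) : x ∈ S := by
  obtain ⟨p, h1, h2, h3⟩ := h
  exact h3 _ p.start_mem_support

theorem PP.right_mem {S : Set V} {x y : V} {n : ℕ} (h : PP G S x y n) : y ∈ S := by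
  obtain ⟨p, h1, h2, h3⟩ := h
  exact h3 _ p.end_mem_support

theorem PP.pos {S : Set V} {x y : V} {n : ℕ} (h : PP G S x y n) (hxy : x ≠ y) : 1 ≤ n := by
  obtain ⟨p, h1, h2, h3⟩ := h
  rcases Nat.eq_zero_or_pos n with h0 | h0
  · exact absurd (SimpleGraph.Walk.eq_of_length_eq_zero (h2.trans h0)) hxy
  · exact h0

theorem PP.refl {S : Set V} {x : V} (h : x ∈ S) : PP G S x x 0 :=
  ⟨.nil, by simp, by simp, by simpa using h⟩

theorem PP.edge {x y : V} (h : G.Adj x y) : PP G {x, y} x y 1 :=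
  ⟨.cons h .nil, by simp [h.ne], by simp, by simp⟩

theorem PP.trans {S T : Set V} {x y z : V} {m n : ℕ} (h : PP G S x y m) (h' : PP G T y z n)
    (hST : ∀ v, v ∈ S → v ∈ T → v = y) : PP G (S ∪ T) x z (m + n) := by
  obtain ⟨p, h1, h2, h3⟩ := h
  obtain ⟨q, k1, k2, k3⟩ := h'
  refine ⟨p.append q, ?_, by simp [h2, k2], ?_⟩
  · rw [SimpleGraph.Walk.isPath_def, SimpleGraph.Walk.support_append, List.nodup_append']
    refine ⟨h1.support_nodup, k1.support_nodup.tail, ?_⟩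
    intro v hv hv'
    have hvy : v = y := hST v (h3 v hv) (k3 v (List.mem_of_mem_tail hv'))
    have := k1.support_nodup
    rw [← SimpleGraph.Walk.cons_tail_support, List.nodup_cons] at this
    exact this.1 (hvy ▸ hv')
  · intro v hv
    rw [SimpleGraph.Walk.mem_support_append_iff] at hv
    rcases hv with hv | hv
    · exact Or.inl (h3 v hv)
    · exact Or.inr (k3 v hv)

theorem PP.glue {S T : Set V} {x y : V} {m n : ℕ} (h : PP G S x y m) (h' : PP G T x y n)
    (hST : ∀ v, v ∈ S → v ∈ T → v = x ∨ v = y) (hxy : x ≠ y) (hmn : 3 ≤ m + n) :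
    Cyc G (S ∪ T) (m + n) := by
  obtain ⟨p, h1, h2, h3⟩ := h
  obtain ⟨q, k1, k2, k3⟩ := h'.symm
  refine ⟨x, p.append q, ?_, by simp [h2, k2], ?_⟩
  · apply h1.isCycle_append k1
    · intro v hv hv'
      have a1 := h1.support_nodup
      rw [← SimpleGraph.Walk.cons_tail_support, List.nodup_cons] at a1
      have a2 := k1.support_nodup
      rw [← SimpleGraph.Walk.cons_tail_support, List.nodup_cons] at a2
      rcases hST v (h3 v (List.mem_of_mem_tail hv)) (k3 v (List.mem_of_mem_tail hv')) with e | e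
      · exact a1.1 (e ▸ hv)
      · exact a2.1 (e ▸ hv')
    · omega
  · intro v hv
    rw [SimpleGraph.Walk.mem_support_append_iff] at hv
    rcases hv with hv | hv
    · exact Or.inl (h3 v hv)
    · exact Or.inr (k3 v hv)

theorem PP.lk {S : Set V} {x y : V} {n : ℕ} (h : PP G S x y n) : Lk G S x y := by
  obtain ⟨p, h1, h2, h3⟩ := h
  exact ⟨p, h3⟩

theorem Lk.pp {S : Set V} {x y : V} (h : Lk G S x y) : ∃ n, PP G S x y n := by
  classical
  obtain ⟨p, h3⟩ := h
  exact ⟨_, p.bypass, p.bypass_isPath, rfl, fun v hv => h3 v (p.support_bypass_subset_support hv)⟩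

theorem Lk.mono {S T : Set V} {x y : V} (h : Lk G S x y) (hST : S ⊆ T) : Lk G T x y := by
  obtain ⟨p, h3⟩ := h
  exact ⟨p, fun v hv => hST (h3 v hv)⟩

theorem Lk.symm {S : Set V} {x y : V} (h : Lk G S x y) : Lk G S y x := by
  obtain ⟨p, h3⟩ := h
  exact ⟨p.reverse, fun v hv => h3 v (by simpa using hv)⟩

theorem Lk.refl {S : Set V} {x : V} (h : x ∈ S) : Lk G S x x := ⟨.nil, by simpa using h⟩

theorem Lk.edge {S : Set V} {x y : V} (h : G.Adj x y) (hx : x ∈ S) (hy : y ∈ S) : Lk G S x y :=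
  ⟨.cons h .nil, by simp [hx, hy]⟩

theorem Lk.trans {S : Set V} {x y z : V} (h : Lk G S x y) (h' : Lk G S y z) : Lk G S x z := by
  obtain ⟨p, h3⟩ := h
  obtain ⟨q, k3⟩ := h'
  refine ⟨p.append q, ?_⟩
  intro v hv
  rw [SimpleGraph.Walk.mem_support_append_iff] at hv
  rcases hv with hv | hv
  · exact h3 v hv
  · exact k3 v hv

theorem Lk.right_mem {S : Set V} {x y : V} (h : Lk G S x y) : y ∈ S := by
  obtain ⟨p, h3⟩ := h
  exact h3 _ p.end_mem_support

/-- first hit of `T`. -/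
theorem Lk.hit {S T : Set V} {a b : V} (h : Lk G S a b) (hb : b ∈ T) :
    ∃ t ∈ T, t ∈ S ∧ Lk G ((S \ T) ∪ {t}) a t := by
  obtain ⟨p, hp⟩ := h
  induction p with
  | nil => exact ⟨_, hb, hp _ (by simp), Lk.refl (by simp)⟩
  | @cons u v w e p ih =>
    have hu : u ∈ S := hp u (by simp)
    by_cases hT : u ∈ T
    · exact ⟨u, hT, hu, Lk.refl (by simp)⟩
    · obtain ⟨t, ht, hts, hl⟩ := ih hb (fun x hx => hp x (by simp [hx]))
      refine ⟨t, ht, hts, Lk.trans (Lk.edge e (Or.inl ⟨hu, hT⟩) ?_) hl⟩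
      exact hl.symm.right_mem

/-- boundary edge. -/
theorem Lk.boundary {S T : Set V} {a b : V} (h : Lk G S a b) (ha : a ∈ T) (hb : b ∉ T) :
    ∃ v w, v ∈ S ∧ v ∈ T ∧ w ∈ S ∧ w ∉ T ∧ G.Adj v w := by
  obtain ⟨p, hp⟩ := h
  induction p with
  | nil => exact absurd ha hb
  | @cons u v w e p ih =>
    by_cases hT : v ∈ T
    · exact ih hT hb (fun x hx => hp x (by simp [hx]))
    · exact ⟨u, v, hp u (by simp), ha, hp v (by simp), hT, e⟩

theorem lk_induce {S : Set V} {x y : S} (r : (G.induce S).Walk x y) : Lk G S x.1 y.1 := by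
  induction r with
  | nil => exact Lk.refl (Subtype.property _)
  | @cons u v w e p ih =>
    exact Lk.trans (Lk.edge (by simpa using e) u.2 v.2) ih

/-- separation property of 3-connected graphs -/
theorem sep (h3 : KConnected 3 G) (p q : V) (W : Set V) {a b : V} (ha : a ∈ W) (hap : a ≠ p)
    (haq : a ≠ q) (hb : b ∉ W) (hbp : b ≠ p) (hbq : b ≠ q) :
    ∃ v w, v ∈ W ∧ w ∉ W ∧ v ≠ p ∧ v ≠ q ∧ w ≠ p ∧ w ≠ q ∧ G.Adj v w := by
  have hc := h3.2 {p, q} (by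
    have := Set.ncard_insert_le p {q}
    rw [Set.ncard_singleton] at this
    omega)
  obtain ⟨r⟩ := hc.preconnected ⟨a, by simp [hap, haq]⟩ ⟨b, by simp [hbp, hbq]⟩
  have hl : Lk G ({p, q}ᶜ : Set V) a b := by
    exact lk_induce r
  obtain ⟨v, w, h1, h2, h4, h5, h6⟩ := hl.boundary ha hb
  simp only [Set.mem_compl_iff, Set.mem_insert_iff, Set.mem_singleton_iff, not_or] at h1 h4
  exact ⟨v, w, h2, h5, h1.1, h1.2, h4.1, h4.2, h6⟩

/-- path from a sequence -/
theorem arcP (c : ℕ → V) (i j : ℕ) (hij : i ≤ j)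
    (hadj : ∀ l, i ≤ l → l < j → G.Adj (c l) (c (l + 1)))
    (hinj : ∀ l m, i ≤ l → l ≤ j → i ≤ m → m ≤ j → c l = c m → l = m) :
    PP G {v | ∃ l, i ≤ l ∧ l ≤ j ∧ c l = v} (c i) (c j) (j - i) := by
  induction j, hij using Nat.le_induction with
  | base => simpa using PP.refl (G := G) (x := c i) (S := {v | ∃ l, i ≤ l ∧ l ≤ i ∧ c l = v})
              ⟨i, le_rfl, le_rfl, rfl⟩
  | succ j hij ih =>
    have h1 := ih (fun l h1 h2 => hadj l h1 (by omega))
      (fun l m h1 h2 h3 h4 => hinj l m h1 (by omega) h3 (by omega))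
    have h2 := PP.edge (hadj j hij (by omega))
    have h3 := h1.trans h2 (by
      rintro v ⟨l, hl1, hl2, rfl⟩ hv
      rcases hv with hv | hv
      · exact hv
      · have := hinj l (j+1) hl1 (by omega) (by omega) le_rfl hv
        omega)
    rw [show j + 1 - i = j - i + 1 by omega]
    refine h3.mono ?_
    rintro v (⟨l, hl1, hl2, rfl⟩ | hv)
    · exact ⟨l, hl1, by omega, rfl⟩
    · rcases hv with hv | hv
      · exact ⟨j, hij, by omega, hv.symm⟩
      · exact ⟨j + 1, by omega, le_rfl, hv.symm⟩

/-- sequence from a path -/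
theorem PP.seq {S : Set V} {x y : V} {n : ℕ} (h : PP G S x y n) :
    ∃ e : ℕ → V, e 0 = x ∧ e n = y ∧ (∀ l, e l ∈ S) ∧ (∀ l, l < n → G.Adj (e l) (e (l + 1))) ∧
      (∀ l m, l ≤ n → m ≤ n → e l = e m → l = m) := by
  obtain ⟨p, h1, h2, h3⟩ := h
  refine ⟨p.getVert, by simp, by simp [← h2], fun l => h3 _ (p.getVert_mem_support l), ?_, ?_⟩
  · intro l hl
    exact p.adj_getVert_succ (by omega)
  · intro l m hl hm he
    exact h1.getVert_injOn (by simp; omega) (by simp; omega) he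

/-- A cycle as a periodic sequence. -/
structure IsC (G : SimpleGraph V) (c : ℕ → V) (n : ℕ) : Prop where
  adj : ∀ i, G.Adj (c i) (c (i + 1))
  per : ∀ i, c (i + n) = c i
  inj : ∀ i j, i < n → j < n → c i = c j → i = j
  three : 3 ≤ n

theorem IsC.modn {c : ℕ → V} {n : ℕ} (h : IsC G c n) (i : ℕ) : c (i % n) = c i := by
  have h0 := h.three
  induction i using Nat.strong_induction_on with
  | _ i ih =>
    by_cases hi : i < n
    · rw [Nat.mod_eq_of_lt hi]
    · have := ih (i - n) (by omega)
      rw [← Nat.mod_eq_sub_mod (by omega)] at this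
      rw [this, ← h.per (i - n), Nat.sub_add_cancel (by omega)]

theorem IsC.shift {c : ℕ → V} {n : ℕ} (h : IsC G c n) (s : ℕ) : IsC G (fun i => c (s + i)) n where
  adj i := h.adj (s + i)
  per i := by simpa [add_assoc] using h.per (s + i)
  three := h.three
  inj i j hi hj he := by
    have h0 := h.three
    have he' : c (s + i) = c (s + j) := he
    rw [← h.modn (s + i), ← h.modn (s + j)] at he'
    have h1 := h.inj _ _ (Nat.mod_lt _ (by omega)) (Nat.mod_lt _ (by omega)) he'
    have h2 : i ≡ j [MOD n] := Nat.ModEq.add_left_cancel' s h1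
    exact Nat.ModEq.eq_of_lt_of_lt h2 hi hj

theorem IsC.inj' {c : ℕ → V} {n : ℕ} (h : IsC G c n) (i j : ℕ) (hi : i ≤ n) (hj : j ≤ n)
    (he : c i = c j) : i = j ∨ (i = 0 ∧ j = n) ∨ (i = n ∧ j = 0) := by
  have h0 := h.per 0
  rw [zero_add] at h0
  have h3 := h.three
  rcases Nat.lt_or_ge i n with h1 | h1
  · rcases Nat.lt_or_ge j n with h2 | h2
    · exact Or.inl (h.inj _ _ h1 h2 he)
    · have : j = n := by omega
      subst this
      have := h.inj i 0 h1 (by omega) (he.trans h0)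
      omega
  · have : i = n := by omega
    subst this
    rcases Nat.lt_or_ge j i with h2 | h2
    · have := h.inj j 0 h2 (by omega) (he.symm.trans h0)
      omega
    · left; omega

theorem IsC.lt_idx {c : ℕ → V} {n : ℕ} (h : IsC G c n) (i : ℕ) : ∃ j, j < n ∧ c j = c i := by
  have := h.three
  exact ⟨i % n, Nat.mod_lt _ (by omega), h.modn i⟩

/-- indices measured from a base point `s` -/
theorem IsC.rel_idx {c : ℕ → V} {n : ℕ} (h : IsC G c n) (s i : ℕ) :
    ∃ j, j < n ∧ c (s + j) = c i := by
  have h3 := h.three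
  obtain ⟨j, hj, hji⟩ := h.lt_idx i
  obtain ⟨t, ht, hts⟩ := h.lt_idx s
  rcases Nat.lt_or_ge j t with h1 | h1
  · refine ⟨j + n - t, by omega, ?_⟩
    rw [← hji, ← h.modn, ← h.modn j]
    congr 1
    have : t = s % n := h.inj _ _ ht (Nat.mod_lt _ (by omega)) (hts.trans (h.modn s).symm)
    rw [Nat.add_mod, ← this, ← Nat.mod_eq_of_lt ht, ← Nat.add_mod, Nat.mod_eq_of_lt ht,
      show t + (j + n - t) = j + n by omega, Nat.add_mod_right]
  · refine ⟨j - t, by omega, ?_⟩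
    rw [← hji, ← h.modn, ← h.modn j]
    congr 1
    have : t = s % n := h.inj _ _ ht (Nat.mod_lt _ (by omega)) (hts.trans (h.modn s).symm)
    rw [Nat.add_mod, ← this, ← Nat.mod_eq_of_lt ht, ← Nat.add_mod, Nat.mod_eq_of_lt ht,
      show t + (j - t) = j by omega]

theorem IsC.arc {c : ℕ → V} {n : ℕ} (h : IsC G c n) (i j : ℕ) (hij : i ≤ j) (hj : j ≤ n)
    (hne : ¬ (i = 0 ∧ j = n)) :
    PP G {v | ∃ l, i ≤ l ∧ l ≤ j ∧ c l = v} (c i) (c j) (j - i) := by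
  apply arcP c i j hij (fun l _ _ => h.adj l)
  intro l m h1 h2 h3 h4 he
  have := h.inj' l m (by omega) (by omega) he
  omega

theorem cyc_seq {x : V} {w : G.Walk x x} (hw : w.IsCycle) :
    ∃ c : ℕ → V, IsC G c w.length ∧ c 0 = x ∧ ∀ v, v ∈ w.support ↔ ∃ i, c i = v := by
  have h3 := hw.three_le_length
  refine ⟨fun i => w.getVert (i % w.length), ⟨?_, ?_, ?_, h3⟩, by simp, ?_⟩
  · intro i
    have hlt : i % w.length < w.length := Nat.mod_lt _ (by omega)
    have ha := w.adj_getVert_succ hlt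
    by_cases he : i % w.length + 1 = w.length
    · have : (i + 1) % w.length = 0 := by
        rw [← Nat.mod_add_mod, he, Nat.mod_self]
      simp only [this]
      rw [he] at ha
      simpa using ha
    · have : (i + 1) % w.length = i % w.length + 1 := by
        rw [← Nat.mod_add_mod, Nat.mod_eq_of_lt (by omega)]
      simpa only [this] using ha
  · intro i; simp
  · intro i j hi hj he
    simp only [Nat.mod_eq_of_lt hi, Nat.mod_eq_of_lt hj] at he
    exact hw.getVert_injOn' (by simp; omega) (by simp; omega) he
  · intro v
    constructor
    · intro hv
      obtain ⟨m, hm, hle⟩ := SimpleGraph.Walk.mem_support_iff_exists_getVert.1 hv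
      rcases Nat.lt_or_ge m w.length with h | h
      · exact ⟨m, by simpa [Nat.mod_eq_of_lt h] using hm⟩
      · have : m = w.length := by omega
        refine ⟨0, ?_⟩
        subst this
        simpa using hm
    · rintro ⟨i, rfl⟩
      exact w.getVert_mem_support _

/-- paths of both parities -/
def Both (G : SimpleGraph V) (S : Set V) (x y : V) : Prop :=
  ∀ r, ∃ n, n % 2 = r % 2 ∧ PP G S x y n

theorem Both.mono {S T : Set V} {x y : V} (h : Both G S x y) (hST : S ⊆ T) : Both G T x y := by
  intro r
  obtain ⟨n, h1, h2⟩ := h r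
  exact ⟨n, h1, h2.mono hST⟩

theorem Both.symm {S : Set V} {x y : V} (h : Both G S x y) : Both G S y x := by
  intro r
  obtain ⟨n, h1, h2⟩ := h r
  exact ⟨n, h1, h2.symm⟩

theorem Both.trans {S T : Set V} {x y z : V} {m : ℕ} (h : Both G S x y) (h' : PP G T y z m)
    (hST : ∀ v, v ∈ S → v ∈ T → v = y) : Both G (S ∪ T) x z := by
  intro r
  obtain ⟨n, h1, h2⟩ := h (r + m)
  exact ⟨n + m, by omega, h2.trans h' hST⟩

theorem PP.cons {F : Set V} {x h q : V} {n : ℕ} (hp : PP G F h q n) (e : G.Adj x h) (hx : x ∉ F) :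
    PP G (insert x F) x q (n + 1) := by
  have := (PP.edge e).trans hp (by
    rintro v (hv | hv) hF
    · rw [hv] at hF; exact absurd hF hx
    · exact hv)
  rw [add_comm] at this
  refine this.mono ?_
  rintro v ((hv | hv) | hv)
  · exact Or.inl hv
  · right; rw [hv]; exact hp.left_mem
  · exact Or.inr hv

/-- any two vertices joined by paths of both parities -/
def Core (G : SimpleGraph V) (Q : Set V) : Prop := ∀ x ∈ Q, ∀ y ∈ Q, x ≠ y → Both G Q x y

theorem core_cycle {d : ℕ → V} {n : ℕ} (hd : IsC G d n) (hn : n % 2 = 1) :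
    Core G {v | ∃ i, d i = v} := by
  rintro x ⟨i, rfl⟩ y ⟨j, rfl⟩ hxy
  obtain ⟨l, hl, hlj⟩ := hd.rel_idx i j
  have hd' := hd.shift i
  rw [← hlj] at hxy ⊢
  have hl0 : 0 < l := by
    rcases Nat.eq_zero_or_pos l with h | h
    · subst h; simp at hxy
    · exact h
  have a1 := hd'.arc 0 l (by omega) (by omega) (by omega)
  have a2 := (hd'.arc l n (by omega) (by omega) (by omega)).symm
  have e : d (i + n) = d i := hd.per i
  simp only [e, add_zero] at a1 a2
  have s1 : {v | ∃ m, 0 ≤ m ∧ m ≤ l ∧ d (i + m) = v} ⊆ {v | ∃ i, d i = v} := by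
    rintro v ⟨m, -, -, hm⟩; exact ⟨_, hm⟩
  have s2 : {v | ∃ m, l ≤ m ∧ m ≤ n ∧ d (i + m) = v} ⊆ {v | ∃ i, d i = v} := by
    rintro v ⟨m, -, -, hm⟩; exact ⟨_, hm⟩
  intro r
  by_cases hr : l % 2 = r % 2
  · exact ⟨_, by simpa using hr, a1.mono s1⟩
  · exact ⟨_, by omega, a2.mono s2⟩

theorem core_ear {Q : Set V} (hQ : Core G Q) (e : ℕ → V) (n : ℕ) (h0 : e 0 ∈ Q) (hn : e n ∈ Q)
    (hint : ∀ l, 0 < l → l < n → e l ∉ Q) (hadj : ∀ l, l < n → G.Adj (e l) (e (l + 1)))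
    (hinj : ∀ l m, l ≤ n → m ≤ n → e l = e m → l = m) (hpos : 0 < n) :
    Core G (Q ∪ {v | ∃ l, l ≤ n ∧ e l = v}) := by
  set E : Set V := {v | ∃ l, l ≤ n ∧ e l = v} with hE
  have arc : ∀ i j, i ≤ j → j ≤ n → PP G {v | ∃ l, i ≤ l ∧ l ≤ j ∧ e l = v} (e i) (e j) (j - i) :=
    fun i j hij hj => arcP e i j hij (fun l _ _ => hadj l (by omega))
      (fun l m _ _ _ _ => hinj l m (by omega) (by omega))
  have inE : ∀ i j, j ≤ n → {v | ∃ l, i ≤ l ∧ l ≤ j ∧ e l = v} ⊆ E := by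
    rintro i j hj v ⟨l, -, hl, rfl⟩
    exact ⟨l, by omega, rfl⟩
  have inQ : ∀ l, l ≤ n → e l ∈ Q → l = 0 ∨ l = n := by
    intro l hl hq
    by_contra hcon
    exact hint l (by omega) (by omega) hq
  have hne : e 0 ≠ e n := fun h => by have := hinj 0 n (by omega) le_rfl h; omega
  have A : ∀ x ∈ Q, ∀ l, 0 < l → l < n → Both G (Q ∪ E) x (e l) := by
    intro x hx l hl hln
    by_cases hx0 : x = e 0
    · have b := (hQ x hx (e n) hn (by rw [hx0]; exact hne)).trans (arc l n (by omega) le_rfl).symm (by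
        rintro v hv ⟨m, hm1, hm2, rfl⟩
        rcases inQ m (by omega) hv with h | h
        · omega
        · rw [h])
      exact b.mono (Set.union_subset_union_right _ (inE _ _ (by omega)))
    · have b := (hQ x hx (e 0) h0 hx0).trans (arc 0 l (by omega) (by omega)) (by
        rintro v hv ⟨m, hm1, hm2, rfl⟩
        rcases inQ m (by omega) hv with h | h
        · rw [h]
        · omega)
      exact b.mono (Set.union_subset_union_right _ (inE _ _ (by omega)))
  have B : ∀ l l', 0 < l → l < l' → l' < n → Both G (Q ∪ E) (e l) (e l') := by
    intro l l' hl hll hln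
    have b := (hQ (e 0) h0 (e n) hn hne).trans (arc l' n (by omega) le_rfl).symm (by
        rintro v hv ⟨m, hm1, hm2, rfl⟩
        rcases inQ m (by omega) hv with h | h
        · omega
        · rw [h])
    have b2 := b.symm.trans (arc 0 l (by omega) (by omega)) (by
        rintro v hv ⟨m, hm1, hm2, rfl⟩
        rcases hv with hv | ⟨m', hm3, hm4, he⟩
        · rcases inQ m (by omega) hv with h | h
          · rw [h]
          · omega
        · have := hinj _ _ (by omega) (by omega) he
          omega)
    refine b2.symm.mono ?_
    rintro v ((hv | hv) | hv)
    · exact Or.inl hv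
    · exact Or.inr (inE _ _ le_rfl hv)
    · exact Or.inr (inE _ _ (by omega) hv)
  have C : ∀ y ∈ Q ∪ E, y ∈ Q ∨ ∃ l, 0 < l ∧ l < n ∧ e l = y := by
    rintro y (hy | ⟨l, hl, rfl⟩)
    · exact Or.inl hy
    · by_cases hq : e l ∈ Q
      · exact Or.inl hq
      · refine Or.inr ⟨l, ?_, ?_, rfl⟩
        · rcases Nat.eq_zero_or_pos l with h | h
          · subst h; exact absurd h0 hq
          · exact h
        · rcases Nat.lt_or_ge l n with h | h
          · exact h
          · have : l = n := by omega
            subst this; exact absurd hn hq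
  intro x hx y hy hxy
  rcases C x hx with hx | ⟨l, hl, hln, rfl⟩
  · rcases C y hy with hy | ⟨l, hl, hln, rfl⟩
    · exact (hQ x hx y hy hxy).mono Set.subset_union_left
    · exact A x hx l hl hln
  · rcases C y hy with hy | ⟨l', hl', hln', rfl⟩
    · exact (A y hy l hl hln).symm
    · rcases Nat.lt_trichotomy l l' with h | h | h
      · exact B l l' hl h hln'
      · subst h; exact absurd rfl hxy
      · exact (B l' l hl' h hln).symm

theorem Lk.comp {S : Set V} {a b : V} (h : Lk G S a b) : Lk G {v | Lk G S a v} a b := by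
  classical
  obtain ⟨p, hp⟩ := h
  refine ⟨p, fun v hv => ⟨p.takeUntil v hv, fun w hw => hp w (p.support_takeUntil_subset_support hv hw)⟩⟩

theorem bags [Finite V] {H D : Set V} (hH : Conn G H) (hD : Core G D) (hDH : D ⊆ H) {d0 : V}
    (hd0 : d0 ∈ D) :
    ∃ Q : Set V, D ⊆ Q ∧ Q ⊆ H ∧ Core G Q ∧ ∃ π : V → V, (∀ q ∈ Q, π q = q) ∧ (∀ h ∈ H, π h ∈ Q) ∧
      (∀ h ∈ H, Lk G {v | v ∈ H ∧ π v = π h} h (π h)) ∧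
      (∀ h ∈ H, ∀ h' ∈ H, G.Adj h h' → (h ∈ Q ∧ h' ∈ Q) ∨ π h = π h') := by
  classical
  obtain ⟨Q, hQm⟩ := Set.Finite.exists_maximal
    (Set.toFinite {Q : Set V | D ⊆ Q ∧ Q ⊆ H ∧ Core G Q}) ⟨D, le_rfl, hDH, hD⟩
  obtain ⟨hDQ, hQH, hQ⟩ := hQm.prop
  have hmax : ∀ Q', D ⊆ Q' → Q' ⊆ H → Core G Q' → Q ⊆ Q' → Q' ⊆ Q :=
    fun Q' h1 h2 h3 h4 => hQm.le_of_ge ⟨h1, h2, h3⟩ h4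
  have M : ∀ h1 h2 q q', Lk G (H \ Q) h1 h2 → q ∈ Q → q' ∈ Q → G.Adj q h1 → G.Adj h2 q' →
      q = q' := by
    intro h1 h2 q q' hl hq hq' a1 a2
    by_contra hne
    obtain ⟨n, hp⟩ := hl.pp
    have m1 := hp.left_mem
    have m2 := hp.right_mem
    have p1 := hp.cons a1 (fun h => h.2 hq)
    have p2 := p1.symm.cons a2.symm (by
      rintro (h | h)
      · exact hne h.symm
      · exact h.2 hq')
    obtain ⟨e, e0, en, eS, eadj, einj⟩ := p2.symm.seq
    have hint : ∀ l, 0 < l → l < n + 1 + 1 → e l ∉ Q := by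
      intro l hl hln hlQ
      rcases eS l with h | h | h
      · have := einj l (n + 1 + 1) (by omega) le_rfl (h.trans en.symm); omega
      · have := einj l 0 (by omega) (by omega) (h.trans e0.symm); omega
      · exact h.2 hlQ
    have hc := core_ear hQ e (n + 1 + 1) (by rw [e0]; exact hq) (by rw [en]; exact hq') hint eadj einj
      (by omega)
    have hsub := hmax _ (hDQ.trans Set.subset_union_left) (by
      rintro v (hv | ⟨l, hl, rfl⟩)
      · exact hQH hv
      · rcases eS l with h | h | h
        · rw [h]; exact hQH hq'
        · rw [h]; exact hQH hq
        · exact h.1) hc Set.subset_union_left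
    exact hint 1 (by omega) (by omega) (hsub (Or.inr ⟨1, by omega, rfl⟩))
  let E : V → V → Prop := fun h q => q ∈ Q ∧ ∃ h2, Lk G (H \ Q) h h2 ∧ G.Adj h2 q
  have Eex : ∀ h ∈ H, h ∉ Q → ∃ q, E h q := by
    intro h hh hhQ
    obtain ⟨v, w, -, hv, hw, hwn, ha⟩ := (hH h hh d0 (hDH hd0)).boundary (T := {v | Lk G (H \ Q) h v})
      (Lk.refl ⟨hh, hhQ⟩) (fun hl => hl.right_mem.2 (hDQ hd0))
    refine ⟨w, ?_, v, hv, ha⟩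
    by_contra hwQ
    exact hwn (Lk.trans hv (Lk.edge ha hv.right_mem ⟨hw, hwQ⟩))
  have Eun : ∀ h q q', E h q → E h q' → q = q' := by
    rintro h q q' ⟨hq, h2, hl, ha⟩ ⟨hq', h2', hl', ha'⟩
    exact M h2 h2' q q' (hl.symm.trans hl') hq hq' ha.symm ha'
  choose! f hf using Eex
  refine ⟨Q, hDQ, hQH, hQ, fun v => if v ∈ Q then v else f v, ?_, ?_, ?_, ?_⟩
  · intro q hq; simp [hq]
  · intro h hh
    by_cases hq : h ∈ Q
    · simp [hq]
    · simpa [hq] using (hf h hh hq).1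
  · intro h hh
    by_cases hq : h ∈ Q
    · simp only [hq, if_true]
      exact Lk.refl ⟨hh, by simp [hq]⟩
    · obtain ⟨hfq, h2, hl, ha⟩ := hf h hh hq
      simp only [hq, if_false]
      have h1 : {v | Lk G (H \ Q) h v} ⊆ {v | v ∈ H ∧ (if v ∈ Q then v else f v) = f h} := by
        intro v hv
        have hvm := hv.right_mem
        refine ⟨hvm.1, ?_⟩
        rw [if_neg hvm.2]
        exact Eun v _ _ (hf v hvm.1 hvm.2) ⟨hfq, h2, (Lk.symm hv).trans hl, ha⟩
      have h3 := hl.comp.mono h1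
      exact h3.trans (Lk.edge ha h3.right_mem ⟨hQH hfq, by simp [hfq]⟩)
  · intro h hh h' hh' ha
    by_cases hq : h ∈ Q
    · by_cases hq' : h' ∈ Q
      · exact Or.inl ⟨hq, hq'⟩
      · right
        simp only [hq, hq', if_true, if_false]
        exact Eun h' _ _ ⟨hq, h', Lk.refl ⟨hh', hq'⟩, ha.symm⟩ (hf h' hh' hq')
    · right
      by_cases hq' : h' ∈ Q
      · simp only [hq, hq', if_true, if_false]
        exact Eun h _ _ (hf h hh hq) ⟨hq', h, Lk.refl ⟨hh, hq⟩, ha⟩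
      · simp only [hq, hq', if_false]
        obtain ⟨k1, h2, hl, ha'⟩ := hf h' hh' hq'
        have hlk : Lk G (H \ Q) h h' := Lk.edge ha ⟨hh, hq⟩ ⟨hh', hq'⟩
        exact Eun h _ _ (hf h hh hq) ⟨k1, h2, hlk.trans hl, ha'⟩

/-- paths of both parities through `H` -/
def BothH (G : SimpleGraph V) (H : Set V) (x y : V) : Prop :=
  ∀ r, ∃ n, 2 ≤ n ∧ n % 2 = r % 2 ∧ PP G (H ∪ {x, y}) x y n

theorem both_bags {H Q : Set V} (hQH : Q ⊆ H) (hQ : Core G Q) {π : V → V} (h1 : ∀ q ∈ Q, π q = q)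
    (h2 : ∀ h ∈ H, π h ∈ Q) (h3 : ∀ h ∈ H, Lk G {v | v ∈ H ∧ π v = π h} h (π h))
    {x y h h' : V} (hx : x ∉ H) (hy : y ∉ H) (hxy : x ≠ y) (hh : h ∈ H) (hh' : h' ∈ H)
    (a : G.Adj x h) (a' : G.Adj y h') (hne : π h ≠ π h') : BothH G H x y := by
  obtain ⟨n, p⟩ := (h3 h hh).pp
  obtain ⟨n', p'⟩ := (h3 h' hh').pp
  have b := p.cons a (fun hv => hx hv.1)
  have b' := p'.cons a' (fun hv => hy hv.1)
  intro r
  obtain ⟨m, hm, c⟩ := hQ _ (h2 h hh) _ (h2 h' hh') hne (r + n + n')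
  have t1 := b.trans c (by
    rintro v (hv | hv) hvQ
    · rw [hv] at hvQ; exact absurd (hQH hvQ) hx
    · rw [← hv.2, h1 v hvQ])
  have t2 := t1.trans b'.symm (by
    rintro v hv hv'
    rcases hv' with hv' | hv'
    · rcases hv with (hv | hv) | hv
      · exact absurd (hv.symm.trans hv') hxy
      · rw [hv'] at hv; exact absurd hv.1 hy
      · rw [hv'] at hv; exact absurd (hQH hv) hy
    · rcases hv with (hv | hv) | hv
      · rw [hv] at hv'; exact absurd hv'.1 hx
      · exact absurd (hv.2.symm.trans hv'.2) hne
      · rw [← hv'.2, h1 v hv])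
  refine ⟨_, ?_, ?_, t2.mono ?_⟩
  · omega
  · omega
  · rintro v (((hv | hv) | hv) | (hv | hv))
    · exact Or.inr (Or.inl hv)
    · exact Or.inl hv.1
    · exact Or.inl (hQH hv)
    · exact Or.inr (Or.inr hv)
    · exact Or.inl hv.1

/-- configuration: even cycle `c` of length `2k`, connected set `H` off the cycle, containing `D`
except possibly the vertex `u`, which is in `H` or on the cycle. -/
structure Cfg (G : SimpleGraph V) (u : V) (D : Set V) (c : ℕ → V) (k : ℕ) (H : Set V) : Prop where
  cyc : IsC G c (2 * k)
  disj : ∀ i, c i ∉ H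
  conn : Conn G H
  sub : ∀ v ∈ D, v ≠ u → v ∈ H
  uu : u ∈ H ∨ ∃ i, c i = u
  du : ∃ v ∈ D, v ≠ u ∧ G.Adj u v

/-- `H` is of maximum size among all configurations. -/
def MaxH (G : SimpleGraph V) (u : V) (D : Set V) (H : Set V) : Prop :=
  ∀ c k H', Cfg G u D c k H' → H'.ncard ≤ H.ncard

variable {u : V} {D H : Set V} {c : ℕ → V} {k : ℕ}

theorem Cfg.shift (h : Cfg G u D c k H) (s : ℕ) : Cfg G u D (fun i => c (s + i)) k H where
  cyc := h.cyc.shift s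
  disj i := h.disj _
  conn := h.conn
  sub := h.sub
  uu := by
    rcases h.uu with h1 | ⟨i, hi⟩
    · exact Or.inl h1
    · obtain ⟨j, -, hj⟩ := h.cyc.rel_idx s i
      exact Or.inr ⟨j, hj.trans hi⟩
  du := h.du

theorem Cfg.k2 (h : Cfg G u D c k H) : 2 ≤ k := by
  have := h.cyc.three
  omega

theorem Cfg.nbr_u (h : Cfg G u D c k H) : ∃ v ∈ H, G.Adj u v := by
  obtain ⟨v, h1, h2, h3⟩ := h.du
  exact ⟨v, h.sub v h1 h2, h3⟩

theorem Cfg.star [Finite V] (h : Cfg G u D c k H) (hm : MaxH G u D H) {S : Set V} {n : ℕ}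
    (hS : Cyc G S n) (hn : n % 2 = 0) (hSH : ∀ v ∈ S, v ∉ H) {a : V} (ha : a ∉ H)
    (haH : ∃ v ∈ H, G.Adj a v) : a ∈ S := by
  by_contra haS
  obtain ⟨x, w, hw, hwn, hwS⟩ := hS
  obtain ⟨c', hc', -, hc's⟩ := cyc_seq hw
  have hcS : ∀ i, c' i ∈ S := fun i => hwS _ ((hc's _).2 ⟨i, rfl⟩)
  have key : ∀ b, b ∉ H → (∃ v ∈ H, G.Adj b v) → (∀ i, c' i ≠ b) →
      (u ∈ insert b H ∨ ∃ i, c' i = u) → False := by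
    intro b hb ⟨v, hv, hbv⟩ hbc hu
    have hcfg : Cfg G u D c' (n / 2) (insert b H) := by
      refine ⟨?_, ?_, ?_, ?_, hu, h.du⟩
      · rw [show 2 * (n / 2) = w.length by omega]; exact hc'
      · rintro i (hi | hi)
        · exact hbc i hi
        · exact hSH _ (hcS i) hi
      · have hb0 : ∀ y ∈ H, Lk G (insert b H) b y := fun y hy =>
          Lk.trans (Lk.edge hbv (Or.inl rfl) (Or.inr hv))
            ((h.conn v hv y hy).mono (Set.subset_insert _ _))
        rintro y (rfl | hy) z (rfl | hz)
        · exact Lk.refl (Or.inl rfl)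
        · exact hb0 z hz
        · exact (hb0 y hy).symm
        · exact (h.conn y hy z hz).mono (Set.subset_insert _ _)
      · intro y hy hyu
        exact Or.inr (h.sub y hy hyu)
    have := hm _ _ _ hcfg
    rw [Set.ncard_insert_of_notMem hb] at this
    omega
  by_cases hu : u ∈ H
  · exact key a ha haH (fun i hi => haS (hi ▸ hcS i)) (Or.inl (Or.inr hu))
  · by_cases hu' : ∃ i, c' i = u
    · exact key a ha haH (fun i hi => haS (hi ▸ hcS i)) (Or.inr hu')
    · exact key u hu h.nbr_u (fun i hi => hu' ⟨i, hi⟩) (Or.inl (Or.inl rfl))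

theorem IsC.toCyc {n : ℕ} (h : IsC G c n) : Cyc G {v | ∃ i, c i = v} n := by
  have h3 := h.three
  have a1 := h.arc 0 1 (by omega) (by omega) (by omega)
  have a2 := (h.arc 1 n (by omega) (by omega) (by omega)).symm
  have e : c n = c 0 := by simpa using h.per 0
  rw [e] at a2
  have g := a1.glue a2 (by
    rintro v ⟨l, h1, h2, rfl⟩ ⟨m, h4, h5, h6⟩
    have := h.inj' m l (by omega) (by omega) h6
    rcases (show l = 0 ∨ l = 1 by omega) with h | h
    · left; rw [h]
    · right; rw [h]) (h.adj 0).ne (by omega)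
  rw [show 1 - 0 + (n - 1) = n by omega] at g
  obtain ⟨x, w, h1, h2, h4⟩ := g
  refine ⟨x, w, h1, h2, fun v hv => ?_⟩
  rcases h4 v hv with ⟨l, -, -, h⟩ | ⟨l, -, -, h⟩ <;> exact ⟨l, h⟩

/-- attachments of `H` are on the cycle. -/
theorem Cfg.att [Finite V] (h : Cfg G u D c k H) (hm : MaxH G u D H) {a : V} (ha : a ∉ H)
    (haH : ∃ v ∈ H, G.Adj a v) : ∃ i, i < 2 * k ∧ c i = a := by
  obtain ⟨i, rfl⟩ := h.star hm h.cyc.toCyc (by omega) (by rintro v ⟨i, rfl⟩; exact h.disj i) ha haH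
  exact h.cyc.lt_idx i

theorem Cfg.third (h : Cfg G u D c k H) (p q : V) : ∃ i, c i ≠ p ∧ c i ≠ q := by
  have k2 := h.k2
  have h01 : c 0 ≠ c 1 := fun e => by have := h.cyc.inj 0 1 (by omega) (by omega) e; omega
  have h02 : c 0 ≠ c 2 := fun e => by have := h.cyc.inj 0 2 (by omega) (by omega) e; omega
  have h12 : c 1 ≠ c 2 := fun e => by have := h.cyc.inj 1 2 (by omega) (by omega) e; omega
  by_contra hcon
  push Not at hcon
  have a0 := hcon 0
  have a1 := hcon 1
  have a2 := hcon 2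
  by_cases e0 : c 0 = p <;> by_cases e1 : c 1 = p <;> by_cases e2 : c 2 = p
  · exact h01 (e0.trans e1.symm)
  · exact h01 (e0.trans e1.symm)
  · exact h02 (e0.trans e2.symm)
  · exact h12 ((a1 e1).trans (a2 e2).symm)
  · exact h12 (e1.trans e2.symm)
  · exact h02 ((a0 e0).trans (a2 e2).symm)
  · exact h01 ((a0 e0).trans (a1 e1).symm)
  · exact h01 ((a0 e0).trans (a1 e1).symm)

theorem Cfg.a3 (h : Cfg G u D c k H) (h3 : KConnected 3 G) {p q : V} (hp : p ∉ H) (hq : q ∉ H) :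
    ∃ a, a ∉ H ∧ a ≠ p ∧ a ≠ q ∧ ∃ v ∈ H, G.Adj a v := by
  obtain ⟨v, hv, -⟩ := h.nbr_u
  obtain ⟨i, hi1, hi2⟩ := h.third p q
  obtain ⟨x, y, hx, hy, -, -, h1, h2, ha⟩ := sep h3 p q H hv (fun e => hp (e ▸ hv))
    (fun e => hq (e ▸ hv)) (h.disj i) hi1 hi2
  exact ⟨y, hy, h1, h2, x, hx, ha.symm⟩

theorem Cfg.theta0 [Finite V] (h : Cfg G u D c k H) (hm : MaxH G u D H) (h3 : KConnected 3 G)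
    {T : Set V} {j n : ℕ} (hj0 : 0 < j) (hj : j < 2 * k) (hp : PP G T (c 0) (c j) n)
    (hTH : ∀ v ∈ T, v ∉ H) (hTc : ∀ i, c i ∈ T → c i = c 0 ∨ c i = c j) (hpar : (n + j) % 2 = 0)
    (hn1 : 3 ≤ n + j) (hn2 : 3 ≤ n + (2 * k - j)) : False := by
  obtain ⟨a, haH, ha0, haj, hav⟩ := h.a3 h3 (h.disj 0) (h.disj j)
  obtain ⟨l, hl, rfl⟩ := h.att hm haH hav
  have hne : c 0 ≠ c j := fun e => by have := h.cyc.inj 0 j (by omega) hj e; omega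
  have e2k : c (2 * k) = c 0 := by simpa using h.cyc.per 0
  rcases Nat.lt_or_ge l j with hlj | hlj
  · have arc := (h.cyc.arc j (2 * k) (by omega) (by omega) (by omega)).symm
    rw [e2k] at arc
    have g := hp.glue arc (by
      rintro v hv ⟨m, -, -, rfl⟩
      exact hTc m hv) hne hn2
    have := h.star hm g (by omega) (by
      rintro v (hv | ⟨m, -, -, rfl⟩)
      · exact hTH v hv
      · exact h.disj m) haH hav
    rcases this with hv | ⟨m, hm1, hm2, hm3⟩
    · rcases hTc l hv with e | e
      · exact ha0 e
      · exact haj e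
    · have := h.cyc.inj' m l (by omega) (by omega) hm3
      rcases this with e | ⟨e, e'⟩ | ⟨e, e'⟩
      · omega
      · omega
      · subst e'; exact ha0 rfl
  · have hlj' : l ≠ j := fun e => haj (by rw [e])
    have arc := (h.cyc.arc 0 j (by omega) (by omega) (by omega))
    have g := hp.glue arc (by
      rintro v hv ⟨m, -, -, rfl⟩
      exact hTc m hv) hne (by omega)
    have := h.star hm g (by omega) (by
      rintro v (hv | ⟨m, -, -, rfl⟩)
      · exact hTH v hv
      · exact h.disj m) haH hav
    rcases this with hv | ⟨m, hm1, hm2, hm3⟩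
    · rcases hTc l hv with e | e
      · exact ha0 e
      · exact haj e
    · have := h.cyc.inj' m l (by omega) (by omega) hm3
      omega

theorem Cfg.theta [Finite V] (h : Cfg G u D c k H) (hm : MaxH G u D H) (h3 : KConnected 3 G)
    {T : Set V} {i j n : ℕ} (hij : i < j) (hj : j < 2 * k) (hp : PP G T (c i) (c j) n)
    (hTH : ∀ v ∈ T, v ∉ H) (hTc : ∀ m, c m ∈ T → c m = c i ∨ c m = c j) (hpar : (n + i + j) % 2 = 0)
    (hn1 : 3 ≤ n + (j - i)) (hn2 : 3 ≤ n + (2 * k - (j - i))) : False := by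
  refine (h.shift i).theta0 hm h3 (T := T) (j := j - i) (n := n) (by omega) (by omega) ?_ hTH ?_
    (by omega) hn1 hn2
  · simpa [show i + (j - i) = j by omega] using hp
  · intro m hmT
    simpa [show i + (j - i) = j by omega] using hTc _ hmT

theorem tri {K : Set V} {x y z : V} (hxy : Lk G K x y) (hxz : Lk G K x z) :
    ∃ n1 n2 n3, PP G K x y n1 ∧ PP G K y z n2 ∧ PP G K x z n3 ∧ (n1 + n2 + n3) % 2 = 0 := by
  obtain ⟨n, hp⟩ := hxy.pp
  obtain ⟨e, e0, en, eS, eadj, einj⟩ := hp.seq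
  obtain ⟨t, ⟨l, hl, rfl⟩, -, hlk⟩ := hxz.symm.hit (T := {v | ∃ l, l ≤ n ∧ e l = v}) ⟨0, by omega, e0⟩
  obtain ⟨m, hq⟩ := hlk.pp
  have arc : ∀ i j, i ≤ j → j ≤ n → PP G {v | ∃ l, i ≤ l ∧ l ≤ j ∧ e l = v} (e i) (e j) (j - i) :=
    fun i j hij hj => arcP e i j hij (fun l _ _ => eadj l (by omega))
      (fun l m _ _ _ _ => einj l m (by omega) (by omega))
  have a1 := (arc 0 l (by omega) hl).trans hq.symm (by
    rintro v ⟨s, hs1, hs2, rfl⟩ (hv | hv)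
    · exact absurd ⟨s, by omega, rfl⟩ hv.2
    · exact hv)
  have a2 := (arc l n (by omega) le_rfl).symm.trans hq.symm (by
    rintro v ⟨s, hs1, hs2, rfl⟩ (hv | hv)
    · exact absurd ⟨s, by omega, rfl⟩ hv.2
    · exact hv)
  rw [e0] at a1
  rw [en] at a2
  refine ⟨n, _, _, hp, a2.mono ?_, a1.mono ?_, by omega⟩
  · rintro v (⟨s, -, -, rfl⟩ | hv | hv)
    · exact eS s
    · exact hv.1
    · rw [hv]; exact eS l
  · rintro v (⟨s, -, -, rfl⟩ | hv | hv)
    · exact eS s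
    · exact hv.1
    · rw [hv]; exact eS l

/-- no vertices off the cycle and off `H` -/
theorem Cfg.cover [Finite V] (h : Cfg G u D c k H) (hm : MaxH G u D H) (h3 : KConnected 3 G)
    {v0 : V} (hv0 : v0 ∉ H) : ∃ i, c i = v0 := by
  by_contra hcon
  set R : Set V := {v | v ∉ H ∧ ∀ i, c i ≠ v} with hR
  have hv0R : v0 ∈ R := ⟨hv0, fun i hi => hcon ⟨i, hi⟩⟩
  have attach : ∀ i j, ∃ l, l < 2 * k ∧ c l ≠ c i ∧ c l ≠ c j ∧ ∃ v, Lk G R v0 v ∧ G.Adj (c l) v := by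
    intro i j
    obtain ⟨m, hm1, hm2⟩ := h.third (c i) (c j)
    obtain ⟨x, y, hx, hy, -, -, h1, h2, ha⟩ := sep h3 (c i) (c j) {v | Lk G R v0 v} (Lk.refl hv0R)
      (fun e => hcon ⟨i, e.symm⟩) (fun e => hcon ⟨j, e.symm⟩)
      (fun hl => hl.right_mem.2 m rfl) hm1 hm2
    have hxR := hx.right_mem
    have hyc : ∃ i, c i = y := by
      by_contra hyc
      by_cases hyH : y ∈ H
      · obtain ⟨s, -, hs⟩ := h.att hm hxR.1 ⟨y, hyH, ha⟩
        exact hxR.2 s hs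
      · exact hy (Lk.trans hx (Lk.edge ha hxR ⟨hyH, fun i hi => hyc ⟨i, hi⟩⟩))
    obtain ⟨s, rfl⟩ := hyc
    obtain ⟨l, hl, hls⟩ := h.cyc.lt_idx s
    exact ⟨l, hl, by rwa [hls], by rwa [hls], x, hx, by rw [hls]; exact ha.symm⟩
  have pair0 : ∀ i j v w n, i < j → j < 2 * k → PP G R v w n →
      G.Adj (c i) v → G.Adj (c j) w → (n + i + j) % 2 = 1 := by
    intro i j v w n hij hj hp a1 a2
    by_contra hpar
    have hne : c i ≠ c j := fun e => by have := h.cyc.inj i j (by omega) hj e; omega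
    have p1 := hp.cons a1 (fun hx => hx.2 i rfl)
    have p2 := p1.symm.cons a2 (by
      rintro (hx | hx)
      · exact hne hx.symm
      · exact hx.2 j rfl)
    refine h.theta hm h3 hij hj p2.symm ?_ ?_ (by omega) (by omega) (by omega)
    · rintro x (rfl | rfl | hx)
      · exact h.disj _
      · exact h.disj _
      · exact hx.1
    · rintro m (hx | hx | hx)
      · exact Or.inr hx
      · exact Or.inl hx
      · exact absurd rfl (hx.2 m)
  have pair : ∀ i j v w n, c i ≠ c j → i < 2 * k → j < 2 * k → PP G R v w n →
      G.Adj (c i) v → G.Adj (c j) w → (n + i + j) % 2 = 1 := by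
    intro i j v w n hne hi hj hp a1 a2
    rcases Nat.lt_trichotomy i j with hij | hij | hij
    · exact pair0 i j v w n hij hj hp a1 a2
    · subst hij; exact absurd rfl hne
    · have := pair0 j i w v n hij hi hp.symm a2 a1
      omega
  obtain ⟨i1, b1, -, -, x, hx, ax⟩ := attach 0 0
  obtain ⟨i2, b2, n21, -, y, hy, ay⟩ := attach i1 i1
  obtain ⟨i3, b3, n31, n32, z, hz, az⟩ := attach i1 i2
  obtain ⟨m1, m2, m3, q1, q2, q3, hpar⟩ := tri (hx.symm.trans hy) (hx.symm.trans hz)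
  have r1 := pair i1 i2 x y m1 n21.symm b1 b2 q1 ax ay
  have r2 := pair i2 i3 y z m2 n32.symm b2 b3 q2 ay az
  have r3 := pair i1 i3 x z m3 n31.symm b1 b3 q3 ax az
  omega

/-- every even cycle off `H` covers everything off `H`. -/
theorem Cfg.ham [Finite V] (h : Cfg G u D c k H) (hm : MaxH G u D H) (h3 : KConnected 3 G)
    {S : Set V} {n : ℕ} (hS : Cyc G S n) (hn : n % 2 = 0) (hSH : ∀ v ∈ S, v ∉ H) {v : V}
    (hv : v ∉ H) : v ∈ S := by
  obtain ⟨x, w, hw, hwn, hwS⟩ := hS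
  obtain ⟨c', hc', -, hc's⟩ := cyc_seq hw
  have hcS : ∀ i, c' i ∈ S := fun i => hwS _ ((hc's _).2 ⟨i, rfl⟩)
  have hcfg : Cfg G u D c' (n / 2) H := by
    refine ⟨?_, fun i => hSH _ (hcS i), h.conn, h.sub, ?_, h.du⟩
    · rw [show 2 * (n / 2) = w.length by omega]; exact hc'
    · by_cases hu : u ∈ H
      · exact Or.inl hu
      · right
        exact h.star hm hc'.toCyc (by omega) (by rintro y ⟨i, rfl⟩; exact hSH _ (hcS i)) hu h.nbr_u
  obtain ⟨i, rfl⟩ := hcfg.cover hm h3 hv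
  exact hcS i

theorem Cfg.chord_even [Finite V] (h : Cfg G u D c k H) (hm : MaxH G u D H) (h3 : KConnected 3 G)
    {i j : ℕ} (hij : i < j) (hj : j < 2 * k) (ha : G.Adj (c i) (c j)) (h1 : j ≠ i + 1)
    (h2 : ¬ (i = 0 ∧ j = 2 * k - 1)) : (i + j) % 2 = 0 := by
  by_contra hpar
  refine h.theta hm h3 hij hj (PP.edge ha) ?_ ?_ (by omega) (by omega) (by omega)
  · rintro x (rfl | rfl)
    · exact h.disj _
    · exact h.disj _
  · rintro m (hx | hx)
    · exact Or.inl hx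
    · exact Or.inr hx

theorem fin_lemma {x y : V} {S S' : Set V} {l n : ℕ} (hx : x ≠ y) (p : PP G S x y l)
    (p' : PP G S' x y (l + 2)) (hS : ∀ v ∈ S, v ∉ H) (hS' : ∀ v ∈ S', v ∉ H)
    (q : PP G (H ∪ {x, y}) x y n) (hn : 2 ≤ n) (hpar : (n + l) % 2 = 0) :
    HasTwoConsecEvenCycles G := by
  have hl := p.pos hx
  obtain ⟨a, w, hw, hwl, -⟩ := q.glue p (by
    rintro v (hv | hv | hv) hvS
    · exact absurd hv (hS v hvS)
    · exact Or.inl hv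
    · exact Or.inr hv) hx (by omega)
  obtain ⟨a', w', hw', hwl', -⟩ := q.glue p' (by
    rintro v (hv | hv | hv) hvS
    · exact absurd hv (hS' v hvS)
    · exact Or.inl hv
    · exact Or.inr hv) hx (by omega)
  exact ⟨a, a', w, w', (n + l) / 2, hw, hw', by omega, by omega, by omega⟩

theorem Cfg.dist (h : Cfg G u D c k H) (i : ℕ) (hb : BothH G H (c i) (c (i + (k - 1)))) :
    HasTwoConsecEvenCycles G := by
  have h' := h.shift i
  have k2 := h.k2
  have a1 := h'.cyc.arc 0 (k - 1) (by omega) (by omega) (by omega)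
  have a2 := (h'.cyc.arc (k - 1) (2 * k) (by omega) (by omega) (by omega)).symm
  have e : c (i + 2 * k) = c i := h.cyc.per i
  have hne : c i ≠ c (i + (k - 1)) := fun e => by
    have := h'.cyc.inj 0 (k - 1) (by omega) (by omega) e
    omega
  simp only [e, Nat.add_zero] at a1 a2
  obtain ⟨n, hn2, hnp, hn⟩ := hb (k - 1)
  rw [show 2 * k - (k - 1) = (k - 1 - 0) + 2 by omega] at a2
  exact fin_lemma hne a1 a2 (by rintro v ⟨l, -, -, rfl⟩; exact h.disj _)
    (by rintro v ⟨l, -, -, rfl⟩; exact h.disj _) hn hn2 (by omega)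

theorem Cfg.uC (h : Cfg G u D c k H) (hD : Core G D) (huD : u ∈ D) (hu : u ∉ H) {y : V} (hyu : u ≠ y)
    (hy : y ∉ H) (hyH : ∃ v ∈ H, G.Adj y v) : BothH G H u y := by
  obtain ⟨v, hv, hyv⟩ := hyH
  obtain ⟨d, hdD, hdu, -⟩ := h.du
  obtain ⟨q, hqD, hqH, hl⟩ := (h.conn v hv d (h.sub d hdD hdu)).hit (T := D) hdD
  have hqu : u ≠ q := fun e => hu (e ▸ hqH)
  obtain ⟨m, p⟩ := hl.pp
  have hyD : y ∉ D := fun hh => hy (h.sub y hh hyu.symm)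
  have p2 := (p.cons hyv (by
    rintro (hh | hh)
    · exact hy hh.1
    · exact hy (hh ▸ hqH))).symm
  have b := (hD u huD q hqD hqu).trans p2 (by
    rintro w hw (hh | hh | hh)
    · exact absurd (hh ▸ hw) hyD
    · exact absurd hw hh.2
    · exact hh)
  intro r
  obtain ⟨n', hn', pn'⟩ := (hD u huD q hqD hqu) (r + (m + 1))
  have := pn'.pos hqu
  have pp := pn'.trans p2 (by
    rintro w hw (hh | hh | hh)
    · exact absurd (hh ▸ hw) hyD
    · exact absurd hw hh.2
    · exact hh)
  refine ⟨n' + (m + 1), by omega, by omega, pp.mono ?_⟩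
  rintro w (hw | hw | hw | hw)
  · by_cases hwu : w = u
    · exact Or.inr (Or.inl hwu)
    · exact Or.inl (h.sub w hw hwu)
  · exact Or.inr (Or.inr hw)
  · exact Or.inl hw.1
  · exact Or.inl (hw ▸ hqH)

theorem Cfg.bagsep (h : Cfg G u D c k H) (h3 : KConnected 3 G) {Q : Set V}
    (hD3 : ∀ p q, ∃ d ∈ D, d ≠ p ∧ d ≠ q) (hDQ : D ⊆ Q) (hQH : Q ⊆ H)
    {π : V → V} (h1 : ∀ q ∈ Q, π q = q)
    (h4 : ∀ h ∈ H, ∀ h' ∈ H, G.Adj h h' → (h ∈ Q ∧ h' ∈ Q) ∨ π h = π h') {z1 z2 : V}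
    (hz1 : z1 ∈ H) (hz2 : z2 ∈ H)
    (hz : ∀ a ∉ H, ∀ v ∈ H, G.Adj a v → π v = z1 ∨ π v = z2) : False := by
  obtain ⟨d, hdD, hd1, hd2⟩ := hD3 z1 z2
  have hdQ := hDQ hdD
  obtain ⟨v, w, ⟨hv, hv1, hv2⟩, hw, -, -, hw1, hw2, ha⟩ :=
    sep h3 z1 z2 {v | v ∈ H ∧ π v ≠ z1 ∧ π v ≠ z2} (a := d) (b := c 0)
    ⟨hQH hdQ, by rw [h1 d hdQ]; exact hd1, by rw [h1 d hdQ]; exact hd2⟩ hd1 hd2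
    (fun hh => h.disj 0 hh.1) (fun e => h.disj 0 (e ▸ hz1)) (fun e => h.disj 0 (e ▸ hz2))
  by_cases hwH : w ∈ H
  · have hw' : π w = z1 ∨ π w = z2 := by
      by_contra hcon
      push Not at hcon
      exact hw ⟨hwH, hcon⟩
    rcases h4 v hv w hwH ha with ⟨-, hq⟩ | he
    · rw [h1 w hq] at hw'
      rcases hw' with e | e
      · exact hw1 e
      · exact hw2 e
    · rw [← he] at hw'
      rcases hw' with e | e
      · exact hv1 e
      · exact hv2 e
  · rcases hz w hwH v hv ha.symm with e | e
    · exact hv1 e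
    · exact hv2 e

theorem Cfg.case1 [Finite V] (h : Cfg G u D c k H) (hm : MaxH G u D H) (h3 : KConnected 3 G)
    (hD : Core G D) (huD : u ∈ D) (hD3 : ∀ p q, ∃ d ∈ D, d ≠ p ∧ d ≠ q)
    (hA : ∀ i, ∃ v ∈ H, G.Adj (c i) v) : HasTwoConsecEvenCycles G := by
  have k2 := h.k2
  have hne : ∀ i, c i ≠ c (i + (k - 1)) := fun i e => by
    have := (h.cyc.shift i).inj 0 (k - 1) (by omega) (by omega) e
    omega
  by_cases hu : u ∈ H
  · by_contra hcon
    have hDH : D ⊆ H := fun v hv => by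
      by_cases e : v = u
      · rw [e]; exact hu
      · exact h.sub v hv e
    obtain ⟨Q, hDQ, hQH, hQ, π, p1, p2, p3, p4⟩ := bags h.conn hD hDH huD
    choose g hg hga using hA
    have key : ∀ i v w, v ∈ H → w ∈ H → G.Adj (c i) v → G.Adj (c (i + (k - 1))) w → π v = π w := by
      intro i v w hv hw a1 a2
      by_contra hne'
      exact hcon (h.dist i (both_bags hQH hQ p1 p2 p3 (h.disj _) (h.disj _) (hne i) hv hw a1 a2 hne'))
    have step : ∀ i v w, v ∈ H → w ∈ H → G.Adj (c i) v → G.Adj (c (i + 2)) w → π v = π w := by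
      intro i v w hv hw a1 a2
      have e1 := key (i + 2) w (g (i + 2 + (k - 1))) hw (hg _) a2 (hga _)
      have e2 := key (i + 2 + (k - 1)) (g (i + 2 + (k - 1))) v (hg _) hv (hga _) (by
        rw [show i + 2 + (k - 1) + (k - 1) = i + 2 * k by omega, h.cyc.per]
        exact a1)
      exact (e1.trans e2).symm
    have gg : ∀ j, (∀ v ∈ H, G.Adj (c (2 * j)) v → π v = π (g 0)) ∧
        (∀ v ∈ H, G.Adj (c (2 * j + 1)) v → π v = π (g 1)) := by
      intro j
      induction j with
      | zero =>
        constructor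
        · intro v hv a
          have e1 := step 0 v (g 2) hv (hg 2) a (hga 2)
          have e2 := step 0 (g 0) (g 2) (hg _) (hg 2) (hga _) (hga 2)
          rw [e1, e2]
        · intro v hv a
          have e1 := step 1 v (g 3) hv (hg 3) a (hga 3)
          have e2 := step 1 (g 1) (g 3) (hg _) (hg 3) (hga _) (hga 3)
          rw [e1, e2]
      | succ j ih =>
        constructor
        · intro v hv a
          rw [← step (2 * j) (g (2 * j)) v (hg _) hv (hga _) a]
          exact ih.1 _ (hg _) (hga _)
        · intro v hv a
          have a' : G.Adj (c (2 * j + 1 + 2)) v := by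
            rw [show 2 * j + 1 + 2 = 2 * (j + 1) + 1 by omega]; exact a
          rw [← step (2 * j + 1) (g (2 * j + 1)) v (hg _) hv (hga _) a']
          exact ih.2 _ (hg _) (hga _)
    refine h.bagsep h3 hD3 hDQ hQH p1 p4 (hQH (p2 _ (hg 0))) (hQH (p2 _ (hg 1))) ?_
    intro a ha v hv hav
    obtain ⟨i, -, rfl⟩ := h.att hm ha ⟨v, hv, hav⟩
    rcases Nat.even_or_odd' i with ⟨j, rfl | rfl⟩
    · exact Or.inl ((gg j).1 v hv hav)
    · exact Or.inr ((gg j).2 v hv hav)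
  · obtain ⟨i, rfl⟩ := h.uu.resolve_left hu
    exact h.dist i (h.uC hD huD hu (hne i) (h.disj _) (hA _))

theorem Cfg.case2 [Finite V] (h : Cfg G u D c k H) (hm : MaxH G u D H) (h3 : KConnected 3 G)
    (hD : Core G D) (huD : u ∈ D) (hD3 : ∀ p q, ∃ d ∈ D, d ≠ p ∧ d ≠ q) (hk : k = 2)
    (hA : ¬ ∃ v ∈ H, G.Adj (c 3) v) : HasTwoConsecEvenCycles G := by
  subst hk
  have hA' : ∀ i, i < 3 → ∃ v ∈ H, G.Adj (c i) v := by
    have hex : ∀ j j', j < 3 → j' < 3 → ∃ i, i < 3 ∧ i ≠ j ∧ i ≠ j' ∧ ∃ v ∈ H, G.Adj (c i) v := by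
      intro j j' hj hj'
      obtain ⟨a, ha, h1, h2, hv⟩ := h.a3 h3 (h.disj j) (h.disj j')
      obtain ⟨i, hi, rfl⟩ := h.att hm ha hv
      have : i ≠ 3 := by rintro rfl; exact hA hv
      exact ⟨i, by omega, fun e => h1 (by rw [e]), fun e => h2 (by rw [e]), hv⟩
    intro i hi
    have : ∃ j j', j < 3 ∧ j' < 3 ∧ ∀ l, l < 3 → l ≠ j → l ≠ j' → l = i :=
      ⟨(i + 1) % 3, (i + 2) % 3, by omega, by omega, by omega⟩
    obtain ⟨j, j', hj, hj', hl⟩ := this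
    obtain ⟨l, hl3, h1, h2, hv⟩ := hex j j' hj hj'
    rw [← hl l hl3 h1 h2]
    exact hv
  have hne : ∀ i, c i ≠ c (i + 1) := fun i => (h.cyc.adj i).ne
  by_cases hu : u ∈ H
  · by_contra hcon
    have hDH : D ⊆ H := fun v hv => by
      by_cases e : v = u
      · rw [e]; exact hu
      · exact h.sub v hv e
    obtain ⟨Q, hDQ, hQH, hQ, π, p1, p2, p3, p4⟩ := bags h.conn hD hDH huD
    have key : ∀ i v w, v ∈ H → w ∈ H → G.Adj (c i) v → G.Adj (c (i + 1)) w → π v = π w := by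
      intro i v w hv hw a1 a2
      by_contra hne'
      exact hcon (h.dist i (both_bags hQH hQ p1 p2 p3 (h.disj _) (h.disj _) (hne i) hv hw a1 a2 hne'))
    obtain ⟨v0, hv0, a0⟩ := hA' 0 (by omega)
    obtain ⟨v1, hv1, a1⟩ := hA' 1 (by omega)
    have hz : π v1 ∈ H := hQH (p2 _ hv1)
    refine h.bagsep h3 hD3 hDQ hQH p1 p4 hz hz ?_
    intro a ha v hv hav
    obtain ⟨i, hi, rfl⟩ := h.att hm ha ⟨v, hv, hav⟩
    left
    have : i ≠ 3 := by rintro rfl; exact hA ⟨v, hv, hav⟩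
    rcases (show i = 0 ∨ i = 1 ∨ i = 2 by omega) with rfl | rfl | rfl
    · exact key 0 v v1 hv hv1 hav a1
    · exact (key 0 v0 v hv0 hv a0 hav).symm.trans (key 0 v0 v1 hv0 hv1 a0 a1)
    · exact (key 1 v1 v hv1 hv a1 hav).symm
  · obtain ⟨i, hi⟩ := h.uu.resolve_left hu
    obtain ⟨i, hi4, rfl⟩ : ∃ i, i < 4 ∧ c i = u := by
      obtain ⟨j, hj, e⟩ := h.cyc.lt_idx i
      exact ⟨j, hj, e.trans hi⟩
    have : i ≠ 3 := by rintro rfl; exact hA h.nbr_u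
    rcases (show i < 2 ∨ i = 2 by omega) with hi | rfl
    · exact h.dist i (h.uC hD huD hu (hne i) (h.disj _) (hA' _ (by omega)))
    · have b := h.uC hD huD hu (hne 1).symm (h.disj _) (hA' 1 (by omega))
      refine h.dist 1 ?_
      intro r
      obtain ⟨n, n1, n2, n3⟩ := b r
      exact ⟨n, n1, n2, n3.symm.mono (by
        rintro w (hw | hw | hw)
        · exact Or.inl hw
        · exact Or.inr (Or.inr hw)
        · exact Or.inr (Or.inl hw))⟩

theorem Cfg.nested [Finite V] (h : Cfg G u D c k H) (hm : MaxH G u D H) (h3 : KConnected 3 G)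
    {m i j : ℕ} (hm2 : m + 2 ≤ 2 * k) (ha : G.Adj (c 0) (c m)) (hij : i + 2 ≤ j)
    (hjm : j ≤ m) (hne : ¬ (i = 0 ∧ j = m)) (hpm : m % 2 = 0) (hp : (i + j) % 2 = 0)
    (hb : G.Adj (c i) (c j)) : False := by
  have a1 := h.cyc.arc 0 i (by omega) (by omega) (by omega)
  have a2 := h.cyc.arc j m (by omega) (by omega) (by omega)
  have p1 := a1.trans (PP.edge hb) (by
    rintro v ⟨l, h1, h2, rfl⟩ (e | e)
    · exact e
    · have := h.cyc.inj l j (by omega) (by omega) e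
      omega)
  have p2 := p1.trans a2 (by
    rintro v (⟨l, h1, h2, rfl⟩ | e | e) ⟨l', h3, h4, e'⟩
    · have := h.cyc.inj l' l (by omega) (by omega) e'
      omega
    · rw [e] at e'
      have := h.cyc.inj l' i (by omega) (by omega) e'
      omega
    · exact e)
  have g := p2.glue (PP.edge ha) (by
    rintro v - (e | e)
    · exact Or.inl e
    · exact Or.inr e) ha.ne (by omega)
  have := h.ham hm h3 g (by omega) (by
    rintro v (((⟨l, -, -, rfl⟩ | e | e) | ⟨l, -, -, rfl⟩) | e | e)
    · exact h.disj _
    · rw [e]; exact h.disj _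
    · rw [e]; exact h.disj _
    · exact h.disj _
    · rw [e]; exact h.disj _
    · rw [e]; exact h.disj _) (h.disj (i + 1))
  rcases this with ((⟨l, h1, h2, e⟩ | e | e) | ⟨l, h1, h2, e⟩) | e | e
  · have := h.cyc.inj _ _ (by omega) (by omega) e
    omega
  · have := h.cyc.inj _ _ (by omega) (by omega) e
    omega
  · have := h.cyc.inj _ _ (by omega) (by omega) e
    omega
  · have := h.cyc.inj _ _ (by omega) (by omega) e
    omega
  · have := h.cyc.inj _ _ (by omega) (by omega) e
    omega
  · have := h.cyc.inj _ _ (by omega) (by omega) e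
    omega

theorem Cfg.crossing [Finite V] (h : Cfg G u D c k H) (hm : MaxH G u D H) (h3 : KConnected 3 G)
    (hk : 3 ≤ k) {m i j : ℕ} (ha : G.Adj (c 0) (c m)) (hi : 0 < i) (him : i < m)
    (hmj : m < j) (hj : j < 2 * k) (hpm : m % 2 = 0) (hp : (i + j) % 2 = 0)
    (hb : G.Adj (c i) (c j)) : False := by
  have e2k : c (2 * k) = c 0 := by simpa using h.cyc.per 0
  have c1 : ∀ s, s < 2 * k → s ≤ i ∨ (m ≤ s ∧ s ≤ j) := by
    have a1 := h.cyc.arc 0 i (by omega) (by omega) (by omega)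
    have a2 := (h.cyc.arc m j (by omega) (by omega) (by omega)).symm
    have p1 := a1.trans (PP.edge hb) (by
      rintro v ⟨l, h1, h2, rfl⟩ (e | e)
      · exact e
      · have := h.cyc.inj l j (by omega) (by omega) e
        omega)
    have p2 := p1.trans a2 (by
      rintro v (⟨l, h1, h2, rfl⟩ | e | e) ⟨l', h3, h4, e'⟩
      · have := h.cyc.inj l' l (by omega) (by omega) e'
        omega
      · rw [e] at e'
        have := h.cyc.inj l' i (by omega) (by omega) e'
        omega
      · exact e)
    have g := p2.glue (PP.edge ha) (by
      rintro v - (e | e)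
      · exact Or.inl e
      · exact Or.inr e) ha.ne (by omega)
    intro s hs
    have := h.ham hm h3 g (by omega) (by
      rintro v (((⟨l, -, -, rfl⟩ | e | e) | ⟨l, -, -, rfl⟩) | e | e)
      · exact h.disj _
      · rw [e]; exact h.disj _
      · rw [e]; exact h.disj _
      · exact h.disj _
      · rw [e]; exact h.disj _
      · rw [e]; exact h.disj _) (h.disj s)
    rcases this with ((⟨l, h1, h2, e⟩ | e | e) | ⟨l, h1, h2, e⟩) | e | e
    · have := h.cyc.inj _ _ (by omega) (by omega) e
      omega
    · have := h.cyc.inj _ _ (by omega) (by omega) e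
      omega
    · have := h.cyc.inj _ _ (by omega) (by omega) e
      omega
    · have := h.cyc.inj _ _ (by omega) (by omega) e
      omega
    · have := h.cyc.inj _ _ (by omega) (by omega) e
      omega
    · have := h.cyc.inj _ _ (by omega) (by omega) e
      omega
  have c2 : ∀ s, s < 2 * k → s = 0 ∨ (i ≤ s ∧ s ≤ m) ∨ j ≤ s := by
    have a1 := (h.cyc.arc i m (by omega) (by omega) (by omega)).symm
    have a2 := h.cyc.arc j (2 * k) (by omega) (by omega) (by omega)
    rw [e2k] at a2
    have p1 := a1.trans (PP.edge hb) (by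
      rintro v ⟨l, h1, h2, rfl⟩ (e | e)
      · exact e
      · have := h.cyc.inj l j (by omega) (by omega) e
        omega)
    have p2 := p1.trans a2 (by
      rintro v (⟨l, h1, h2, rfl⟩ | e | e) ⟨l', h3, h4, e'⟩
      · have := h.cyc.inj' l' l (by omega) (by omega) e'
        omega
      · rw [e] at e'
        have := h.cyc.inj' l' i (by omega) (by omega) e'
        omega
      · exact e)
    have g := p2.glue (PP.edge ha.symm) (by
      rintro v - (e | e)
      · exact Or.inl e
      · exact Or.inr e) ha.ne.symm (by omega)
    intro s hs
    have := h.ham hm h3 g (by omega) (by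
      rintro v (((⟨l, -, -, rfl⟩ | e | e) | ⟨l, -, -, rfl⟩) | e | e)
      · exact h.disj _
      · rw [e]; exact h.disj _
      · rw [e]; exact h.disj _
      · exact h.disj _
      · rw [e]; exact h.disj _
      · rw [e]; exact h.disj _) (h.disj s)
    rcases this with ((⟨l, h1, h2, e⟩ | e | e) | ⟨l, h1, h2, e⟩) | e | e
    · have := h.cyc.inj _ _ (by omega) (by omega) e
      omega
    · have := h.cyc.inj _ _ (by omega) (by omega) e
      omega
    · have := h.cyc.inj _ _ (by omega) (by omega) e
      omega
    · have := h.cyc.inj' _ _ (by omega) (by omega) e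
      omega
    · have := h.cyc.inj _ _ (by omega) (by omega) e
      omega
    · have := h.cyc.inj _ _ (by omega) (by omega) e
      omega
  have q1 := c1 (i + 1) (by omega)
  have q3 := c2 1 (by omega)
  have q4 := c2 (m + 1) (by omega)
  have q2 := c1 (2 * k - 1) (by omega)
  omega

theorem Cfg.two_chords [Finite V] (h : Cfg G u D c k H) (hm : MaxH G u D H) (h3 : KConnected 3 G)
    (hk : 3 ≤ k) {m i j : ℕ} (hm0 : 2 ≤ m) (hm2 : m + 2 ≤ 2 * k) (ha : G.Adj (c 0) (c m))
    (hij : i + 2 ≤ j) (hj : j < 2 * k) (hij2 : ¬ (i = 0 ∧ j = 2 * k - 1)) (hne : ¬ (i = 0 ∧ j = m))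
    (hb : G.Adj (c i) (c j)) : False := by
  have hpm : m % 2 = 0 := by
    have := h.chord_even hm h3 (i := 0) (j := m) (by omega) (by omega) ha (by omega) (by omega)
    omega
  have hp := h.chord_even hm h3 (i := i) (j := j) (by omega) (by omega) hb (by omega) (by omega)
  have ha' : G.Adj (c (m + 0)) (c (m + (2 * k - m))) := by
    have e2k : c (2 * k) = c 0 := by simpa using h.cyc.per 0
    rw [show m + (2 * k - m) = 2 * k by omega, e2k]
    exact ha.symm
  rcases Nat.lt_or_ge m j with h1 | h1
  · rcases Nat.lt_or_ge i m with h2 | h2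
    · rcases Nat.eq_zero_or_pos i with h4 | h4
      · subst h4
        refine (h.shift m).nested hm h3 (m := 2 * k - m) (i := j - m) (j := 2 * k - m) (by omega) ha'
          (by omega) (by omega) (by omega) (by omega) (by omega) ?_
        have e2k : c (2 * k) = c 0 := by simpa using h.cyc.per 0
        show G.Adj (c (m + (j - m))) (c (m + (2 * k - m)))
        rw [show m + (2 * k - m) = 2 * k by omega, e2k, show m + (j - m) = j by omega]
        exact hb.symm
      · exact h.crossing hm h3 hk ha h4 h2 h1 hj hpm hp hb
    · refine (h.shift m).nested hm h3 (m := 2 * k - m) (i := i - m) (j := j - m) (by omega) ha'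
          (by omega) (by omega) (by omega) (by omega) (by omega) ?_
      show G.Adj (c (m + (i - m))) (c (m + (j - m)))
      rw [show m + (i - m) = i by omega, show m + (j - m) = j by omega]
      exact hb
  · exact h.nested hm h3 hm2 ha hij h1 hne hpm hp hb

theorem Cfg.chord_ex [Finite V] (h : Cfg G u D c k H) (hm : MaxH G u D H) (h3 : KConnected 3 G)
    (i : ℕ) (hA : ¬ ∃ v ∈ H, G.Adj (c i) v) :
    ∃ m, 2 ≤ m ∧ m + 2 ≤ 2 * k ∧ G.Adj (c i) (c (i + m)) := by
  have h' := h.shift i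
  have k2 := h.k2
  have ne : ∀ s t, s < 2 * k → t < 2 * k → s ≠ t → c (i + s) ≠ c (i + t) := fun s t hs ht hst e =>
    hst (h'.cyc.inj s t hs ht e)
  obtain ⟨v, w, hv, hw, -, -, hw1, hw2, ha⟩ := sep h3 (c (i + 1)) (c (i + (2 * k - 1))) {c (i + 0)}
    (a := c (i + 0)) (b := c (i + 2)) rfl (ne _ _ (by omega) (by omega) (by omega))
    (ne _ _ (by omega) (by omega) (by omega)) (ne 2 0 (by omega) (by omega) (by omega))
    (ne _ _ (by omega) (by omega) (by omega)) (ne _ _ (by omega) (by omega) (by omega))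
  have hv' : v = c i := hv
  subst hv'
  have hwH : w ∉ H := fun hh => hA ⟨w, hh, ha⟩
  obtain ⟨s, rfl⟩ := h.cover hm h3 hwH
  obtain ⟨m, hm1, hm2⟩ := h.cyc.rel_idx i s
  rw [← hm2] at hw hw1 hw2 ha
  have n0 : m ≠ 0 := by rintro rfl; exact hw rfl
  have n1 : m ≠ 1 := by rintro rfl; exact hw1 rfl
  have n2 : m ≠ 2 * k - 1 := by rintro rfl; exact hw2 rfl
  exact ⟨m, by omega, by omega, ha⟩

theorem Cfg.fin3 (h : Cfg G u D c k H) {m : ℕ} (hm0 : 2 ≤ m)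
    (hm2 : m + 4 ≤ 2 * k) (hpm : m % 2 = 0) (ha : G.Adj (c 0) (c m))
    (hA : ∀ l, l < 2 * k → l ≠ 0 → l ≠ m → ∃ v ∈ H, G.Adj (c l) v) : HasTwoConsecEvenCycles G := by
  have e2k : c (2 * k) = c 0 := by simpa using h.cyc.per 0
  obtain ⟨i, rfl⟩ : ∃ i, m = 2 * i := ⟨m / 2, by omega⟩
  obtain ⟨t, ht⟩ : ∃ t, t = k + i - 1 := ⟨_, rfl⟩
  have hne : c i ≠ c t := fun e => by
    have := h.cyc.inj i t (by omega) (by omega) e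
    omega
  obtain ⟨v, hv, hiv⟩ := hA i (by omega) (by omega) (by omega)
  obtain ⟨w, hw, htw⟩ := hA t (by omega) (by omega) (by omega)
  obtain ⟨n, p⟩ := (h.conn v hv w hw).pp
  have q1 := (p.cons hiv (h.disj _)).symm
  have q := (q1.cons htw (by
    rintro (e | e)
    · exact hne e.symm
    · exact h.disj _ e)).symm
  have q' : PP G (H ∪ {c i, c t}) (c i) (c t) (n + 1 + 1) := q.mono (by
    rintro x (e | e | e)
    · exact Or.inr (Or.inr e)
    · exact Or.inr (Or.inl e)
    · exact Or.inl e)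
  have b0 := (h.cyc.arc 0 i (by omega) (by omega) (by omega)).symm
  have b1 := (h.cyc.arc t (2 * k) (by omega) (by omega) (by omega)).symm
  rw [e2k] at b1
  by_cases hpar : (n + 1 + 1 + (k - 1)) % 2 = 0
  · have P1 := h.cyc.arc i t (by omega) (by omega) (by omega)
    have P2 := b0.trans b1 (by
      rintro x ⟨l, h1, h2, rfl⟩ ⟨l', h3, h4, e⟩
      have := h.cyc.inj' l' l (by omega) (by omega) e
      rw [show l = 0 by omega])
    rw [show t - i = k - 1 by omega] at P1
    rw [show i - 0 + (2 * k - t) = k - 1 + 2 by omega] at P2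
    exact fin_lemma hne P1 P2 (by rintro v ⟨l, -, -, rfl⟩; exact h.disj _)
      (by rintro v (⟨l, -, -, rfl⟩ | ⟨l, -, -, rfl⟩) <;> exact h.disj _) q' (by omega) hpar
  · have b2 := h.cyc.arc (2 * i) t (by omega) (by omega) (by omega)
    have b3 := h.cyc.arc i (2 * i) (by omega) (by omega) (by omega)
    have P3 := (b0.trans (PP.edge ha) (by
      rintro x ⟨l, h1, h2, rfl⟩ (e | e)
      · exact e
      · have := h.cyc.inj _ _ (by omega) (by omega) e
        omega)).trans b2 (by
      rintro x (⟨l, h1, h2, rfl⟩ | e | e) ⟨l', h3, h4, e'⟩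
      · have := h.cyc.inj _ _ (by omega) (by omega) e'
        omega
      · rw [e] at e'
        have := h.cyc.inj _ _ (by omega) (by omega) e'
        omega
      · exact e)
    have P4 := (b3.trans (PP.edge ha.symm) (by
      rintro x ⟨l, h1, h2, rfl⟩ (e | e)
      · exact e
      · have := h.cyc.inj _ _ (by omega) (by omega) e
        omega)).trans b1 (by
      rintro x (⟨l, h1, h2, rfl⟩ | e | e) ⟨l', h3, h4, e'⟩
      · have := h.cyc.inj' _ _ (by omega) (by omega) e'
        omega
      · rw [e] at e'
        have := h.cyc.inj' _ _ (by omega) (by omega) e'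
        omega
      · exact e)
    rw [show i - 0 + 1 + (t - 2 * i) = k by omega] at P3
    rw [show 2 * i - i + 1 + (2 * k - t) = k + 2 by omega] at P4
    exact fin_lemma hne P3 P4
      (by
        rintro v ((⟨l, -, -, rfl⟩ | e | e) | ⟨l, -, -, rfl⟩)
        · exact h.disj _
        · rw [e]; exact h.disj _
        · rw [e]; exact h.disj _
        · exact h.disj _)
      (by
        rintro v ((⟨l, -, -, rfl⟩ | e | e) | ⟨l, -, -, rfl⟩)
        · exact h.disj _
        · rw [e]; exact h.disj _
        · rw [e]; exact h.disj _
        · exact h.disj _) q' (by omega) (by omega)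

theorem Cfg.case3' [Finite V] (h : Cfg G u D c k H) (hm : MaxH G u D H) (h3 : KConnected 3 G)
    (hk : 3 ≤ k) {m : ℕ} (hm0 : 2 ≤ m) (hm2 : m + 2 ≤ 2 * k) (ha : G.Adj (c 0) (c m)) :
    HasTwoConsecEvenCycles G := by
  have hpm : m % 2 = 0 := by
    have := h.chord_even hm h3 (i := 0) (j := m) (by omega) (by omega) ha (by omega) (by omega)
    omega
  have e2k : c (2 * k) = c 0 := by simpa using h.cyc.per 0
  have hA : ∀ l, l < 2 * k → l ≠ 0 → l ≠ m → ∃ v ∈ H, G.Adj (c l) v := by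
    intro l hl hl0 hlm
    by_contra hcon
    obtain ⟨s, hs1, hs2, hs⟩ := h.chord_ex hm h3 l hcon
    rcases Nat.lt_or_ge (l + s) (2 * k) with h1 | h1
    · exact h.two_chords hm h3 hk hm0 hm2 ha (i := l) (j := l + s) (by omega) h1 (by omega) (by omega) hs
    · refine h.two_chords hm h3 hk hm0 hm2 ha (i := l + s - 2 * k) (j := l) (by omega) hl (by omega)
        (by omega) ?_
      have := h.cyc.per (l + s - 2 * k)
      rw [show l + s - 2 * k + 2 * k = l + s by omega] at this
      rw [← this]
      exact hs.symm
  rcases Nat.lt_or_ge (2 * k) (m + 4) with h1 | h1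
  · refine (h.shift m).fin3 (m := 2 * k - m) (by omega) (by omega) (by omega) ?_ ?_
    · show G.Adj (c (m + 0)) (c (m + (2 * k - m)))
      rw [show m + (2 * k - m) = 2 * k by omega, e2k]
      exact ha.symm
    · intro l hl hl0 hlm
      rcases Nat.lt_or_ge (m + l) (2 * k) with h2 | h2
      · exact hA (m + l) h2 (by omega) (by omega)
      · have := h.cyc.per (m + l - 2 * k)
        rw [show m + l - 2 * k + 2 * k = m + l by omega] at this
        show ∃ v ∈ H, G.Adj (c (m + l)) v
        rw [this]
        exact hA _ (by omega) (by omega) (by omega)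
  · exact h.fin3 hm0 h1 hpm ha hA

theorem Cfg.final [Finite V] (h : Cfg G u D c k H) (hm : MaxH G u D H) (h3 : KConnected 3 G)
    (hD : Core G D) (huD : u ∈ D) (hD3 : ∀ p q, ∃ d ∈ D, d ≠ p ∧ d ≠ q) :
    HasTwoConsecEvenCycles G := by
  have k2 := h.k2
  by_cases hA : ∀ i, ∃ v ∈ H, G.Adj (c i) v
  · exact h.case1 hm h3 hD huD hD3 hA
  · rw [not_forall] at hA
    obtain ⟨i, hi⟩ := hA
    rcases Nat.lt_or_ge k 3 with hk | hk
    · have hk2 : k = 2 := by omega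
      refine (h.shift (i + 1)).case2 hm h3 hD huD hD3 hk2 ?_
      have := h.cyc.per i
      show ¬ ∃ v ∈ H, G.Adj (c (i + 1 + 3)) v
      rw [show i + 1 + 3 = i + 2 * k by omega, this]
      exact hi
    · obtain ⟨m, h1, h2, ha⟩ := h.chord_ex hm h3 i hi
      exact (h.shift i).case3' hm h3 hk h1 h2 ha

theorem exists_max [Finite V] (h : Cfg G u D c k H) :
    ∃ c k H, Cfg G u D c k H ∧ MaxH G u D H := by
  classical
  obtain ⟨H', ⟨c', k', hc⟩, hmax⟩ := Set.exists_max_image {H : Set V | ∃ c k, Cfg G u D c k H}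
    Set.ncard (Set.toFinite _) ⟨H, c, k, h⟩
  exact ⟨c', k', H', hc, fun c1 k1 H1 h1 => hmax H1 ⟨c1, k1, h1⟩⟩

end ConsecEven

/-- A 3-connected graph containing an even cycle and an odd cycle sharing exactly one
common vertex contains two cycles of consecutive even lengths. -/
theorem stmt_8 {V : Type*} [Fintype V] (G : SimpleGraph V) (h3 : KConnected 3 G)
    {u : V} (b : G.Walk u u) (d : G.Walk u u) (hb : b.IsCycle) (hd : d.IsCycle)
    (hbe : Even b.length) (hdo : Odd d.length)
    (hmeet : ∀ v, v ∈ b.support → v ∈ d.support → v = u) :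
    HasTwoConsecEvenCycles G := by
  obtain ⟨c, hc, hc0, hcs⟩ := ConsecEven.cyc_seq hb
  obtain ⟨e, he, he0, hes⟩ := ConsecEven.cyc_seq hd
  obtain ⟨k, hk⟩ := hbe
  have hodd : d.length % 2 = 1 := Nat.odd_iff.1 hdo
  have n3 := he.three
  have h01 : e 0 ≠ e 1 := fun q => by have := he.inj 0 1 (by omega) (by omega) q; omega
  have h02 : e 0 ≠ e 2 := fun q => by have := he.inj 0 2 (by omega) (by omega) q; omega
  have h12 : e 1 ≠ e 2 := fun q => by have := he.inj 1 2 (by omega) (by omega) q; omega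
  have hcfg : ConsecEven.Cfg G u {v | ∃ i, e i = v} c k {v | (∃ i, e i = v) ∧ v ≠ u} := by
    refine ⟨?_, ?_, ?_, ?_, Or.inr ⟨0, hc0⟩, ?_⟩
    · rw [show 2 * k = b.length by omega]; exact hc
    · rintro i ⟨hi, hne⟩
      exact hne (hmeet _ ((hcs _).2 ⟨i, rfl⟩) ((hes _).2 hi))
    · have key : ∀ i j, 1 ≤ i → i ≤ j → j < d.length →
          ConsecEven.Lk G {v | (∃ i, e i = v) ∧ v ≠ u} (e i) (e j) := by
        intro i j hi hij hj
        refine (he.arc i j hij (by omega) (by omega)).lk.mono ?_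
        rintro v ⟨l, h1, h2, rfl⟩
        refine ⟨⟨l, rfl⟩, fun q => ?_⟩
        rw [← he0] at q
        have := he.inj _ _ (by omega) (by omega) q
        omega
      rintro x ⟨⟨i, rfl⟩, hx⟩ y ⟨⟨j, rfl⟩, hy⟩
      obtain ⟨i', hi', ei⟩ := he.lt_idx i
      obtain ⟨j', hj', ej⟩ := he.lt_idx j
      rw [← ei] at hx ⊢
      rw [← ej] at hy ⊢
      have i0 : i' ≠ 0 := by rintro rfl; exact hx he0
      have j0 : j' ≠ 0 := by rintro rfl; exact hy he0
      rcases Nat.le_total i' j' with hij | hij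
      · exact key _ _ (by omega) hij hj'
      · exact (key _ _ (by omega) hij hi').symm
    · exact fun v hv hvu => ⟨hv, hvu⟩
    · refine ⟨e 1, ⟨1, rfl⟩, ?_, ?_⟩
      · rw [← he0]; exact h01.symm
      · rw [← he0]; exact he.adj 0
  obtain ⟨c', k', H, h, hm⟩ := ConsecEven.exists_max hcfg
  refine h.final hm h3 (ConsecEven.core_cycle he hodd) ⟨0, he0⟩ ?_
  intro p q
  by_contra hcon
  have a : ∀ i, e i ≠ p → e i = q := fun i hi => by
    by_contra hq
    exact hcon ⟨e i, ⟨i, rfl⟩, hi, hq⟩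
  have a0 := a 0
  have a1 := a 1
  have a2 := a 2
  by_cases e0 : e 0 = p <;> by_cases e1 : e 1 = p <;> by_cases e2 : e 2 = p
  · exact h01 (e0.trans e1.symm)
  · exact h01 (e0.trans e1.symm)
  · exact h02 (e0.trans e2.symm)
  · exact h12 ((a1 e1).trans (a2 e2).symm)
  · exact h12 (e1.trans e2.symm)
  · exact h02 ((a0 e0).trans (a2 e2).symm)
  · exact h01 ((a0 e0).trans (a1 e1).symm)
  · exact h01 ((a0 e0).trans (a1 e1).symm)
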